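/- arXiv:2204.07972 — 11 statements merged into one kernel-verified Lean document; each statement's English description precedes it below -/
import Mathlib

section
/- For every (t,θ) ∈ ℝ², the four vectors e₁ = (1/ρ(t))·∂u/∂θ(t,θ), e₂ = (1/ρ(t))·∂u/∂t(t,θ), n₁(t,θ), n₂(t,θ) form an orthonormal basis of ℝ⁴. In particular ⟨∂u/∂t, ∂u/∂θ⟩ = 0 and |∂u/∂t| = |∂u/∂θ| = ρ(t) at every point, i.e. (t,θ) is a conformal coordinate for the parametrized surface with conformal factor ρ(t)². -/
open Real RealInnerProductSpace

/-- `ρ(t) = (k·l/r)·√(sinh²(l·t) + cosh²(k·t))`. -/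
noncomputable def fsRho (k l r t : ℝ) : ℝ :=
  k * l / r * Real.sqrt (Real.sinh (l * t) ^ 2 + Real.cosh (k * t) ^ 2)

/-- The Fraser–Sargent parametrization `u : ℝ² → ℝ⁴`. -/
noncomputable def fsU (k l r : ℝ) (t θ : ℝ) : EuclideanSpace ℝ (Fin 4) :=
  (1 / r) • (EuclideanSpace.equiv (Fin 4) ℝ).symm
    ![k * Real.sinh (l * t) * Real.cos (l * θ),
      k * Real.sinh (l * t) * Real.sin (l * θ),
      l * Real.cosh (k * t) * Real.cos (k * θ),
      l * Real.cosh (k * t) * Real.sin (k * θ)]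

/-- The normal field `n₁`. -/
noncomputable def fsN1 (k l r : ℝ) (t θ : ℝ) : EuclideanSpace ℝ (Fin 4) :=
  (k * l / (r * fsRho k l r t)) • (EuclideanSpace.equiv (Fin 4) ℝ).symm
    ![-(Real.sinh (k * t) * Real.cos (l * θ)),
      -(Real.sinh (k * t) * Real.sin (l * θ)),
      Real.cosh (l * t) * Real.cos (k * θ),
      Real.cosh (l * t) * Real.sin (k * θ)]

/-- The normal field `n₂`. -/
noncomputable def fsN2 (k l r : ℝ) (t θ : ℝ) : EuclideanSpace ℝ (Fin 4) :=
  (k * l / (r * fsRho k l r t)) • (EuclideanSpace.equiv (Fin 4) ℝ).symm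
    ![-(Real.cosh (k * t) * Real.sin (l * θ)),
      Real.cosh (k * t) * Real.cos (l * θ),
      Real.sinh (l * t) * Real.sin (k * θ),
      -(Real.sinh (l * t) * Real.cos (k * θ))]

/-- Derivatives of curves in a Euclidean space are computed coordinatewise. -/
theorem hasDerivAt_euclidean {ι : Type*} [Fintype ι] {f : ℝ → EuclideanSpace ℝ ι}
    {f' : EuclideanSpace ℝ ι} {x : ℝ} :
    HasDerivAt f f' x ↔ ∀ i, HasDerivAt (fun y => f y i) (f' i) x := by
  simp only [hasDerivAt_iff_hasFDerivAt, ← hasFDerivWithinAt_univ, hasFDerivWithinAt_euclidean]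
  refine forall_congr' fun i => ?_
  rw [show EuclideanSpace.proj i ∘L ContinuousLinearMap.toSpanSingleton ℝ f' =
    ContinuousLinearMap.toSpanSingleton ℝ (f' i) by ext; simp]

/-- The `t`-derivative of the Fraser–Sargent parametrization. -/
theorem hasDerivAt_fsU_left (k l r t θ : ℝ) :
    HasDerivAt (fun s => fsU k l r s θ)
      ((k * l / r) • !₂[cosh (l * t) * cos (l * θ), cosh (l * t) * sin (l * θ),
        sinh (k * t) * cos (k * θ), sinh (k * t) * sin (k * θ)]) t := by
  have hA : HasDerivAt (fun s => sinh (l * s)) (cosh (l * t) * l) t := by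
    simpa using ((hasDerivAt_id t).const_mul l).sinh
  have hD : HasDerivAt (fun s => cosh (k * s)) (sinh (k * t) * k) t := by
    simpa using ((hasDerivAt_id t).const_mul k).cosh
  rw [hasDerivAt_euclidean]
  intro i
  fin_cases i
  · exact (((hA.const_mul k).mul_const (cos (l * θ))).const_mul (1 / r)).congr_deriv
      (by simp; ring)
  · exact (((hA.const_mul k).mul_const (sin (l * θ))).const_mul (1 / r)).congr_deriv
      (by simp; ring)
  · exact (((hD.const_mul l).mul_const (cos (k * θ))).const_mul (1 / r)).congr_deriv
      (by simp; ring)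
  · exact (((hD.const_mul l).mul_const (sin (k * θ))).const_mul (1 / r)).congr_deriv
      (by simp; ring)

/-- The `θ`-derivative of the Fraser–Sargent parametrization. -/
theorem hasDerivAt_fsU_right (k l r t θ : ℝ) :
    HasDerivAt (fun φ => fsU k l r t φ)
      ((k * l / r) • !₂[-(sinh (l * t) * sin (l * θ)), sinh (l * t) * cos (l * θ),
        -(cosh (k * t) * sin (k * θ)), cosh (k * t) * cos (k * θ)]) θ := by
  have hcos (a : ℝ) : HasDerivAt (fun φ => cos (a * φ)) (-sin (a * θ) * a) θ := by
    simpa using ((hasDerivAt_id θ).const_mul a).cos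
  have hsin (a : ℝ) : HasDerivAt (fun φ => sin (a * φ)) (cos (a * θ) * a) θ := by
    simpa using ((hasDerivAt_id θ).const_mul a).sin
  rw [hasDerivAt_euclidean]
  intro i
  fin_cases i
  · exact (((hcos l).const_mul (k * sinh (l * t))).const_mul (1 / r)).congr_deriv
      (by simp; ring)
  · exact (((hsin l).const_mul (k * sinh (l * t))).const_mul (1 / r)).congr_deriv
      (by simp; ring)
  · exact (((hcos k).const_mul (l * cosh (k * t))).const_mul (1 / r)).congr_deriv
      (by simp; ring)
  · exact (((hsin k).const_mul (l * cosh (k * t))).const_mul (1 / r)).congr_deriv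
      (by simp; ring)

/-- The algebraic identities behind the orthonormality of the Fraser–Sargent frame. -/
theorem orthonormal_frame {A B C D c₁ s₁ c₂ s₂ w : ℝ} (hw : w ≠ 0) (hw2 : w ^ 2 = A ^ 2 + D ^ 2)
    (hB : B ^ 2 = A ^ 2 + 1) (hD : D ^ 2 = C ^ 2 + 1) (h₁ : s₁ ^ 2 + c₁ ^ 2 = 1)
    (h₂ : s₂ ^ 2 + c₂ ^ 2 = 1) :
    Orthonormal ℝ
      ![w⁻¹ • !₂[-(A * s₁), A * c₁, -(D * s₂), D * c₂],
        w⁻¹ • !₂[B * c₁, B * s₁, C * c₂, C * s₂],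
        w⁻¹ • !₂[-(C * c₁), -(C * s₁), B * c₂, B * s₂],
        w⁻¹ • !₂[-(D * s₁), D * c₁, A * s₂, -(A * c₂)]] := by
  have hw3 : w ^ 2 = B ^ 2 + C ^ 2 := by linarith
  rw [orthonormal_iff_ite]
  intro i j
  fin_cases i <;> fin_cases j <;>
    simp [-inner_self_eq_norm_sq_to_K, inner_smul_left, inner_smul_right, PiLp.inner_apply,
      Fin.sum_univ_four, hw] <;>
    field_simp <;> grind

/-- For every `(t,θ)`, the vectors `e₁ = ρ(t)⁻¹·∂u/∂θ`, `e₂ = ρ(t)⁻¹·∂u/∂t`, `n₁`, `n₂`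
form an orthonormal basis of `ℝ⁴`; in particular `⟨∂u/∂t, ∂u/∂θ⟩ = 0` and
`|∂u/∂t| = |∂u/∂θ| = ρ(t)`, i.e. `(t,θ)` is a conformal coordinate with
conformal factor `ρ(t)²`. -/
theorem stmt_2 (k l T r : ℝ) (hkl : k > l) (hl : l > 0) (hT : 0 < T)
    (hTeq : k * Real.tanh (k * T) = l * (Real.cosh (l * T) / Real.sinh (l * T)))
    (hr : r = Real.sqrt (k ^ 2 * Real.sinh (l * T) ^ 2 + l ^ 2 * Real.cosh (k * T) ^ 2)) :
    ∀ t θ : ℝ,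
      Orthonormal ℝ
        ![(fsRho k l r t)⁻¹ • deriv (fun φ => fsU k l r t φ) θ,
          (fsRho k l r t)⁻¹ • deriv (fun s => fsU k l r s θ) t,
          fsN1 k l r t θ, fsN2 k l r t θ] ∧
      Submodule.span ℝ
        (Set.range
          ![(fsRho k l r t)⁻¹ • deriv (fun φ => fsU k l r t φ) θ,
            (fsRho k l r t)⁻¹ • deriv (fun s => fsU k l r s θ) t,
            fsN1 k l r t θ, fsN2 k l r t θ]) = ⊤ ∧
      ⟪deriv (fun s => fsU k l r s θ) t, deriv (fun φ => fsU k l r t φ) θ⟫ = 0 ∧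
      ‖deriv (fun s => fsU k l r s θ) t‖ = fsRho k l r t ∧
      ‖deriv (fun φ => fsU k l r t φ) θ‖ = fsRho k l r t := by
  intro t θ
  have hk : 0 < k := hl.trans hkl
  have hr0 : 0 < r := by
    rw [hr]
    have := cosh_pos (k * T)
    positivity
  have hc : 0 < k * l / r := by positivity
  have hW : 0 < sinh (l * t) ^ 2 + cosh (k * t) ^ 2 := by
    have := cosh_pos (k * t)
    positivity
  set w := √(sinh (l * t) ^ 2 + cosh (k * t) ^ 2) with hw
  have hw0 : 0 < w := sqrt_pos.2 hW
  have hρ : fsRho k l r t = k * l / r * w := rfl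
  have hρ0 : 0 < fsRho k l r t := hρ ▸ mul_pos hc hw0
  have hcoef : (fsRho k l r t)⁻¹ * (k * l / r) = w⁻¹ := by
    rw [hρ]
    field_simp
  have hcoef' : k * l / (r * fsRho k l r t) = w⁻¹ := by
    rw [← hcoef]
    field_simp
  have ho : Orthonormal ℝ
      ![(fsRho k l r t)⁻¹ • deriv (fun φ => fsU k l r t φ) θ,
        (fsRho k l r t)⁻¹ • deriv (fun s => fsU k l r s θ) t,
        fsN1 k l r t θ, fsN2 k l r t θ] := by
    rw [(hasDerivAt_fsU_right k l r t θ).deriv, (hasDerivAt_fsU_left k l r t θ).deriv,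
      smul_smul, smul_smul, hcoef, fsN1, fsN2, hcoef']
    exact orthonormal_frame hw0.ne' (sq_sqrt hW.le) (cosh_sq _) (cosh_sq _)
      (sin_sq_add_cos_sq _) (sin_sq_add_cos_sq _)
  refine ⟨ho, ho.linearIndependent.span_eq_top_of_card_eq_finrank' (by simp), ?_, ?_, ?_⟩
  · have h := ho.inner_eq_zero (i := 1) (j := 0) (by decide)
    simpa [inner_smul_left, inner_smul_right, hρ0.ne'] using h
  · have h := ho.norm_eq_one 1
    simp only [Matrix.cons_val, norm_smul, norm_inv, norm_of_nonneg hρ0.le] at h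
    field_simp at h
    exact h
  · have h := ho.norm_eq_one 0
    simp only [Matrix.cons_val, norm_smul, norm_inv, norm_of_nonneg hρ0.le] at h
    field_simp at h
    exact h
end

section
/- For all (t,θ) ∈ ℝ², |u(t,θ)|² = (k²·sinh²(l·t) + l²·cosh²(k·t))/r². Consequently |u(t,θ)| < 1 if and only if |t| < T, |u(t,θ)| = 1 if and only if |t| = T, and |u(t,θ)| > 1 if and only if |t| > T. -/
open Real RealInnerProductSpace

/-- The squared norm of the unnormalized Fraser–Sargent parametrization. -/
noncomputable def fsEnergy (k l t : ℝ) : ℝ :=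
  k ^ 2 * Real.sinh (l * t) ^ 2 + l ^ 2 * Real.cosh (k * t) ^ 2

theorem fsEnergy_abs (k l t : ℝ) : fsEnergy k l |t| = fsEnergy k l t := by
  rcases abs_choice t with h | h <;> simp [h, fsEnergy]

theorem fsEnergy_strictMonoOn {k l : ℝ} (hk : 0 < k) (hl : 0 < l) :
    StrictMonoOn (fsEnergy k l) (Set.Ici 0) := by
  intro a ha b _ hab
  have ha : 0 ≤ a := ha
  have hs : Real.sinh (l * a) < Real.sinh (l * b) := by
    rw [Real.sinh_lt_sinh]
    gcongr
  have hs₀ : 0 ≤ Real.sinh (l * a) := Real.sinh_nonneg_iff.2 (by positivity)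
  have hc : Real.cosh (k * a) < Real.cosh (k * b) := by
    rw [Real.cosh_lt_cosh, abs_of_nonneg (by positivity),
      abs_of_nonneg (mul_nonneg hk.le (ha.trans hab.le))]
    gcongr
  have hc₀ := Real.cosh_pos (k * a)
  unfold fsEnergy
  gcongr

theorem fsEnergy_pos (k t : ℝ) {l : ℝ} (hl : 0 < l) : 0 < fsEnergy k l t := by
  have := Real.cosh_pos (k * t)
  unfold fsEnergy
  positivity

theorem norm_fsU_sq (k l r t θ : ℝ) : ‖fsU k l r t θ‖ ^ 2 = fsEnergy k l t / r ^ 2 := by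
  rw [EuclideanSpace.norm_sq_eq]
  simp only [fsU, fsEnergy, Fin.sum_univ_four, Real.norm_eq_abs, sq_abs]
  simp
  linear_combination (k ^ 2 * Real.sinh (l * t) ^ 2 / r ^ 2) * Real.sin_sq_add_cos_sq (l * θ) +
    (l ^ 2 * Real.cosh (k * t) ^ 2 / r ^ 2) * Real.sin_sq_add_cos_sq (k * θ)

/-- `|u(t,θ)|² = (k²·sinh²(l·t) + l²·cosh²(k·t))/r²`; consequently `|u| < 1 ↔ |t| < T`,
`|u| = 1 ↔ |t| = T` and `|u| > 1 ↔ |t| > T`. -/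
theorem stmt_4 (k l T r : ℝ) (hkl : k > l) (hl : l > 0) (hT : 0 < T)
    (hTeq : k * Real.tanh (k * T) = l * (Real.cosh (l * T) / Real.sinh (l * T)))
    (hr : r = Real.sqrt (k ^ 2 * Real.sinh (l * T) ^ 2 + l ^ 2 * Real.cosh (k * T) ^ 2)) :
    ∀ t θ : ℝ,
      ‖fsU k l r t θ‖ ^ 2 =
        (k ^ 2 * Real.sinh (l * t) ^ 2 + l ^ 2 * Real.cosh (k * t) ^ 2) / r ^ 2 ∧
      (‖fsU k l r t θ‖ < 1 ↔ |t| < T) ∧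
      (‖fsU k l r t θ‖ = 1 ↔ |t| = T) ∧
      (‖fsU k l r t θ‖ > 1 ↔ |t| > T) := by
  intro t θ
  have hk : 0 < k := hl.trans hkl
  have hE := fsEnergy_pos k T hl
  have hr2 : r ^ 2 = fsEnergy k l T := by rw [hr]; exact Real.sq_sqrt hE.le
  have hnorm : ‖fsU k l r t θ‖ ^ 2 = fsEnergy k l |t| / fsEnergy k l T := by
    rw [norm_fsU_sq, hr2, fsEnergy_abs]
  have hmono := fsEnergy_strictMonoOn hk hl
  have ht : |t| ∈ Set.Ici (0 : ℝ) := abs_nonneg t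
  have hT' : T ∈ Set.Ici (0 : ℝ) := hT.le
  have h0 := norm_nonneg (fsU k l r t θ)
  refine ⟨norm_fsU_sq k l r t θ, ?_, ?_, ?_⟩
  · rw [← sq_lt_one_iff₀ h0, hnorm, div_lt_one hE, hmono.lt_iff_lt ht hT']
  · rw [← pow_eq_one_iff_of_nonneg h0 two_ne_zero, hnorm, div_eq_one_iff_eq hE.ne', hmono.injOn.eq_iff ht hT']
  · rw [gt_iff_lt, gt_iff_lt, ← one_lt_sq_iff₀ h0, hnorm, one_lt_div hE, hmono.lt_iff_lt hT' ht]
end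

section
/- One has ρ(T) = k·tanh(k·T) = l·coth(l·T), and for every θ ∈ ℝ the identity ∂u/∂t(T,θ) = ρ(T)·u(T,θ) holds. In other words, along the curve t = T the position vector u is normal to the unit sphere's tangent plane up to the tangential direction ∂u/∂θ, so the Fraser–Sargent surface meets the unit sphere ∂B⁴ orthogonally (the free boundary condition). -/
open Real RealInnerProductSpace

/-- The `t`-derivative of the Fraser–Sargent parametrization. -/
theorem hasDerivAt_fsU (k l r t θ : ℝ) :
    HasDerivAt (fun s => fsU k l r s θ)
      ((1 / r) • (EuclideanSpace.equiv (Fin 4) ℝ).symm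
        ![k * (Real.cosh (l * t) * l) * Real.cos (l * θ),
          k * (Real.cosh (l * t) * l) * Real.sin (l * θ),
          l * (Real.sinh (k * t) * k) * Real.cos (k * θ),
          l * (Real.sinh (k * t) * k) * Real.sin (k * θ)]) t := by
  have hlin (c : ℝ) : HasDerivAt (fun s => c * s) c t := by
    simpa using (hasDerivAt_id t).const_mul c
  have hsinh := ((hlin l).sinh).const_mul k
  have hcosh := ((hlin k).cosh).const_mul l
  refine HasDerivAt.const_smul (1 / r)
    ((EuclideanSpace.equiv (Fin 4) ℝ).symm.hasFDerivAt.comp_hasDerivAt t (hasDerivAt_pi.2 ?_))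
  intro i
  fin_cases i
  · exact hsinh.mul_const _
  · exact hsinh.mul_const _
  · exact hcosh.mul_const _
  · exact hcosh.mul_const _

/-- If `k tanh (k T) = l coth (l T)`, then `ρ(T)` is this common value. -/
theorem fsRho_eq_mul_tanh {k l T r : ℝ} (hk : 0 < k) (hl : 0 < l) (hT : 0 < T)
    (hTeq : k * Real.tanh (k * T) = l * (Real.cosh (l * T) / Real.sinh (l * T)))
    (hr : r = Real.sqrt (k ^ 2 * Real.sinh (l * T) ^ 2 + l ^ 2 * Real.cosh (k * T) ^ 2)) :
    fsRho k l r T = k * Real.tanh (k * T) := by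
  have hS : 0 < Real.sinh (l * T) := Real.sinh_pos_iff.2 (by positivity)
  have hB : 0 < Real.sinh (k * T) := Real.sinh_pos_iff.2 (by positivity)
  have hA : 0 < Real.cosh (k * T) := Real.cosh_pos _
  have hr0 : 0 < r := by rw [hr]; positivity
  have hr2 : r ^ 2 = k ^ 2 * Real.sinh (l * T) ^ 2 + l ^ 2 * Real.cosh (k * T) ^ 2 := by
    rw [hr, Real.sq_sqrt (by positivity)]
  have hC2 := Real.cosh_sq (l * T)
  have hA2 := Real.cosh_sq (k * T)
  rw [Real.tanh_eq_sinh_div_cosh] at hTeq ⊢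
  unfold fsRho
  generalize Real.sinh (l * T) = S at *
  generalize Real.sinh (k * T) = B at *
  generalize Real.cosh (k * T) = A at *
  generalize Real.cosh (l * T) = C at *
  have hcross : k * B * S = l * C * A := by
    field_simp at hTeq
    linarith
  have hsqrt : Real.sqrt (S ^ 2 + A ^ 2) = B * r / (l * A) := by
    rw [Real.sqrt_eq_iff_mul_self_eq (by positivity) (by positivity)]
    field_simp
    rw [hr2]
    linear_combination -(k * B * S + l * C * A) * hcross - l ^ 2 * A ^ 2 * hC2
      + l ^ 2 * A ^ 2 * hA2
  rw [hsqrt]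
  field_simp

/-- `ρ(T) = k·tanh(k·T) = l·coth(l·T)`, and for every `θ` one has
`∂u/∂t(T,θ) = ρ(T)·u(T,θ)`: the Fraser–Sargent surface meets the unit sphere
orthogonally (the free boundary condition). -/
theorem stmt_5 (k l T r : ℝ) (hkl : k > l) (hl : l > 0) (hT : 0 < T)
    (hTeq : k * Real.tanh (k * T) = l * (Real.cosh (l * T) / Real.sinh (l * T)))
    (hr : r = Real.sqrt (k ^ 2 * Real.sinh (l * T) ^ 2 + l ^ 2 * Real.cosh (k * T) ^ 2)) :
    fsRho k l r T = k * Real.tanh (k * T) ∧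
    fsRho k l r T = l * (Real.cosh (l * T) / Real.sinh (l * T)) ∧
    ∀ θ : ℝ, deriv (fun s => fsU k l r s θ) T = fsRho k l r T • fsU k l r T θ := by
  have hρ := fsRho_eq_mul_tanh (hl.trans hkl) hl hT hTeq hr
  refine ⟨hρ, hρ.trans hTeq, fun θ => ?_⟩
  have hS : Real.sinh (l * T) ≠ 0 := (Real.sinh_pos_iff.2 (by positivity)).ne'
  have hA : Real.cosh (k * T) ≠ 0 := (Real.cosh_pos _).ne'
  have hsinh : Real.cosh (l * T) * l = fsRho k l r T * Real.sinh (l * T) := by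
    rw [hρ, hTeq]
    field_simp
  have hcosh : Real.sinh (k * T) * k = fsRho k l r T * Real.cosh (k * T) := by
    rw [hρ, Real.tanh_eq_sinh_div_cosh]
    field_simp
  rw [(hasDerivAt_fsU k l r T θ).deriv, hsinh, hcosh]
  ext i
  fin_cases i <;> simp [fsU] <;> ring
end

section
/- The function t ↦ (d/dt) log ρ(t) satisfies lim_{t→+∞} (log ρ)'(t) = k and lim_{t→−∞} (log ρ)'(t) = −k, so the improper integral ∫_{−∞}^{∞} (d²/dt²) log ρ(t) dt converges and equals 2k. Consequently, for the conformal metric ρ(t)²(dt² + dθ²) on ℝ × [0,2π], whose Gauss curvature is K(t) = −ρ(t)^{−2}·(log ρ)''(t), the total Gauss curvature ∫_{−∞}^{∞} ∫_0^{2π} K(t)·ρ(t)² dθ dt equals −4πk. -/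
open Real RealInnerProductSpace

open Filter MeasureTheory

theorem hasDerivAt_real_tanh (x : ℝ) : HasDerivAt Real.tanh (1 / Real.cosh x ^ 2) x := by
  have h := (Real.hasDerivAt_sinh x).div (Real.hasDerivAt_cosh x) (Real.cosh_pos x).ne'
  have e : Real.tanh = Real.sinh / Real.cosh := funext Real.tanh_eq_sinh_div_cosh
  rw [e]
  refine h.congr_deriv ?_
  congr 1
  linear_combination Real.cosh_sq x

theorem tendsto_real_tanh_atTop : Tendsto Real.tanh atTop (nhds 1) := by
  have h : Tendsto (fun x : ℝ => (1 - Real.exp (-(2 * x))) / (1 + Real.exp (-(2 * x))))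
      atTop (nhds ((1 - 0) / (1 + 0))) := by
    have h0 : Tendsto (fun x : ℝ => Real.exp (-(2 * x))) atTop (nhds 0) :=
      Real.tendsto_exp_neg_atTop_nhds_zero.comp (tendsto_id.const_mul_atTop two_pos)
    exact (h0.const_sub 1).div (h0.const_add 1) (by norm_num)
  refine (h.congr fun x => ?_).trans (by norm_num)
  rw [Real.tanh_eq_sinh_div_cosh, Real.sinh_eq, Real.cosh_eq]
  have e : Real.exp (-(2 * x)) = Real.exp (-x) * Real.exp (-x) := by
    rw [← Real.exp_add]; ring_nf
  have e1 : Real.exp x * Real.exp (-x) = 1 := by rw [← Real.exp_add]; simp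
  have := Real.exp_pos x
  have := Real.exp_pos (-x)
  rw [e, div_eq_div_iff (by positivity) (by positivity)]
  linear_combination (-Real.exp (-x)) * e1

theorem tendsto_real_tanh_atBot : Tendsto Real.tanh atBot (nhds (-1)) := by
  refine (tendsto_real_tanh_atTop.comp tendsto_neg_atBot_atTop).neg.congr fun x => ?_
  simp [Real.tanh_neg]

/-- A continuous nonnegative derivative of a function with finite limits at `±∞` is integrable. -/
theorem integrable_of_hasDerivAt_of_nonneg_of_tendsto {g g' : ℝ → ℝ} {m n : ℝ}
    (hderiv : ∀ x, HasDerivAt g (g' x) x) (hcont : Continuous g') (hpos : ∀ x, 0 ≤ g' x)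
    (hbot : Tendsto g atBot (nhds m)) (htop : Tendsto g atTop (nhds n)) : Integrable g' := by
  refine integrable_of_intervalIntegral_norm_tendsto (n - m)
    (fun i : ℝ => (hcont.integrableOn_Icc (a := -i) (b := i)).mono_set Set.Ioc_subset_Icc_self)
    tendsto_neg_atTop_atBot tendsto_id ?_
  refine (htop.sub (hbot.comp tendsto_neg_atTop_atBot)).congr fun i => ?_
  simp only [Real.norm_of_nonneg (hpos _)]
  exact (intervalIntegral.integral_eq_sub_of_hasDerivAt (fun x _ => hderiv x)
    (hcont.intervalIntegrable _ _)).symm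

theorem sinh_sq_add_cosh_sq_eq_cosh_mul_cosh (x y : ℝ) :
    Real.sinh x ^ 2 + Real.cosh y ^ 2 = Real.cosh (y + x) * Real.cosh (y - x) := by
  rw [Real.cosh_add, Real.cosh_sub]
  linear_combination (-Real.cosh y ^ 2) * Real.cosh_sq x - Real.sinh x ^ 2 * Real.cosh_sq y

theorem log_fsRho {k l r : ℝ} (hk : k ≠ 0) (hl : l ≠ 0) (hr : r ≠ 0) (t : ℝ) :
    Real.log (fsRho k l r t) = Real.log (k * l / r) +
      (Real.log (Real.cosh ((k + l) * t)) + Real.log (Real.cosh ((k - l) * t))) / 2 := by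
  have h₁ := Real.cosh_pos ((k + l) * t)
  have h₂ := Real.cosh_pos ((k - l) * t)
  rw [fsRho, sinh_sq_add_cosh_sq_eq_cosh_mul_cosh, ← add_mul, ← sub_mul,
    Real.log_mul (by positivity) (by positivity), Real.log_sqrt (by positivity),
    Real.log_mul h₁.ne' h₂.ne']

theorem deriv_log_fsRho {k l r : ℝ} (hk : k ≠ 0) (hl : l ≠ 0) (hr : r ≠ 0) :
    deriv (fun s => Real.log (fsRho k l r s)) = fun t =>
      ((k + l) * Real.tanh ((k + l) * t) + (k - l) * Real.tanh ((k - l) * t)) / 2 := by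
  have hcosh (a t : ℝ) : HasDerivAt (fun s => Real.log (Real.cosh (a * s)))
      (a * Real.tanh (a * t)) t := by
    convert (((hasDerivAt_id' t).const_mul a).cosh).log (Real.cosh_pos _).ne' using 1
    rw [Real.tanh_eq_sinh_div_cosh]
    ring
  funext t
  simp only [log_fsRho hk hl hr]
  exact (((hcosh (k + l) t).add (hcosh (k - l) t)).div_const 2 |>.const_add _).deriv

/-- `(log ρ)' → k` at `+∞` and `→ −k` at `−∞`, so `∫_{−∞}^{∞} (log ρ)'' dt` converges
and equals `2k`; consequently, for the conformal metric `ρ(t)²(dt² + dθ²)` on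
`ℝ × [0,2π]` with Gauss curvature `K(t) = −ρ(t)⁻²·(log ρ)''(t)`, the total Gauss
curvature `∫∫ K·ρ² dθ dt` equals `−4πk`. -/
theorem stmt_7 (k l T r : ℝ) (hkl : k > l) (hl : l > 0) (hT : 0 < T)
    (hTeq : k * Real.tanh (k * T) = l * (Real.cosh (l * T) / Real.sinh (l * T)))
    (hr : r = Real.sqrt (k ^ 2 * Real.sinh (l * T) ^ 2 + l ^ 2 * Real.cosh (k * T) ^ 2)) :
    Tendsto (fun t => deriv (fun s => Real.log (fsRho k l r s)) t) atTop (nhds k) ∧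
    Tendsto (fun t => deriv (fun s => Real.log (fsRho k l r s)) t) atBot (nhds (-k)) ∧
    Integrable (fun t => deriv (deriv (fun s => Real.log (fsRho k l r s))) t) ∧
    (∫ t : ℝ, deriv (deriv (fun s => Real.log (fsRho k l r s))) t) = 2 * k ∧
    Integrable (fun t => ∫ θ in (0:ℝ)..(2 * Real.pi),
      (-(1 / fsRho k l r t ^ 2) * deriv (deriv (fun s => Real.log (fsRho k l r s))) t) *
        fsRho k l r t ^ 2) ∧
    (∫ t : ℝ, ∫ θ in (0:ℝ)..(2 * Real.pi),
      (-(1 / fsRho k l r t ^ 2) * deriv (deriv (fun s => Real.log (fsRho k l r s))) t) *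
        fsRho k l r t ^ 2) = -4 * Real.pi * k := by
  have hk : 0 < k := hl.trans hkl
  have hr0 : 0 < r := by
    have := Real.sinh_pos_iff.2 (mul_pos hl hT)
    rw [hr]
    positivity
  have hp : 0 < k + l := add_pos hk hl
  have hq : 0 < k - l := sub_pos.2 hkl
  have hderiv := deriv_log_fsRho hk.ne' hl.ne' hr0.ne'
  have htop : Tendsto (deriv fun s => Real.log (fsRho k l r s)) atTop (nhds k) := by
    have h (a : ℝ) (ha : 0 < a) : Tendsto (fun t => a * Real.tanh (a * t)) atTop (nhds (a * 1)) :=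
      (tendsto_real_tanh_atTop.comp (tendsto_id.const_mul_atTop ha)).const_mul a
    rw [hderiv]
    convert ((h _ hp).add (h _ hq)).div_const 2 using 2
    ring
  have hbot : Tendsto (deriv fun s => Real.log (fsRho k l r s)) atBot (nhds (-k)) := by
    have h (a : ℝ) (ha : 0 < a) :
        Tendsto (fun t => a * Real.tanh (a * t)) atBot (nhds (a * -1)) :=
      (tendsto_real_tanh_atBot.comp (tendsto_id.const_mul_atBot ha)).const_mul a
    rw [hderiv]
    convert ((h _ hp).add (h _ hq)).div_const 2 using 2
    ring
  have hderiv₂ (t : ℝ) : HasDerivAt (deriv fun s => Real.log (fsRho k l r s))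
      (((k + l) ^ 2 / Real.cosh ((k + l) * t) ^ 2 +
        (k - l) ^ 2 / Real.cosh ((k - l) * t) ^ 2) / 2) t := by
    have h (a : ℝ) : HasDerivAt (fun s => a * Real.tanh (a * s))
        (a ^ 2 / Real.cosh (a * t) ^ 2) t := by
      refine (((hasDerivAt_real_tanh (a * t)).comp t
        ((hasDerivAt_id' t).const_mul a)).const_mul a).congr_deriv ?_
      ring
    rw [hderiv]
    exact ((h _).add (h _)).div_const 2
  have hint : Integrable (deriv (deriv fun s => Real.log (fsRho k l r s))) := by
    rw [funext fun t => (hderiv₂ t).deriv]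
    refine integrable_of_hasDerivAt_of_nonneg_of_tendsto hderiv₂ ?_ (fun t => by positivity)
      hbot htop
    have h (a : ℝ) : Continuous fun t => a ^ 2 / Real.cosh (a * t) ^ 2 :=
      continuous_const.div (by fun_prop) fun t => (pow_pos (Real.cosh_pos _) 2).ne'
    exact ((h _).add (h _)).div_const 2
  have hval : ∫ t, deriv (deriv fun s => Real.log (fsRho k l r s)) t = 2 * k := by
    rw [integral_of_hasDerivAt_of_tendsto
      (fun t => (hderiv₂ t).differentiableAt.hasDerivAt) hint hbot htop]
    ring
  have hcurv (t : ℝ) : (∫ _ in (0:ℝ)..(2 * Real.pi),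
      (-(1 / fsRho k l r t ^ 2) * deriv (deriv (fun s => Real.log (fsRho k l r s))) t) *
        fsRho k l r t ^ 2) =
      -(2 * Real.pi) * deriv (deriv (fun s => Real.log (fsRho k l r s))) t := by
    have hρ : fsRho k l r t ≠ 0 := by
      unfold fsRho
      have := Real.cosh_pos (k * t)
      positivity
    rw [intervalIntegral.integral_const, smul_eq_mul]
    field_simp
    ring
  simp only [hcurv]
  refine ⟨htop, hbot, hint, hval, hint.const_mul _, ?_⟩
  rw [integral_const_mul, hval]
  ring
end

section
/- For all (t,θ) ∈ ℝ²: ⟨∂n₁/∂θ (t,θ), n₂(t,θ)⟩ = −b(t) and ⟨∂n₁/∂t (t,θ), n₂(t,θ)⟩ = 0. (These are the connection coefficients of the normal connection of the Fraser–Sargent surface in the orthonormal normal frame n₁, n₂.) -/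
open Real RealInnerProductSpace

/-- `a(t)`, the coefficient of the Simons operator in the `n₁` direction. -/
noncomputable def fsa (k l r t : ℝ) : ℝ :=
  k ^ 2 * l ^ 2 / (r ^ 2 * fsRho k l r t ^ 2) *
    (k * Real.cosh (l * t) * Real.cosh (k * t) - l * Real.sinh (l * t) * Real.sinh (k * t))

/-- `b(t)`, the connection coefficient of the normal connection. -/
noncomputable def fsb (k l r t : ℝ) : ℝ :=
  k ^ 2 * l ^ 2 / (r ^ 2 * fsRho k l r t ^ 2) *
    (l * Real.sinh (k * t) * Real.cosh (k * t) + k * Real.sinh (l * t) * Real.cosh (l * t))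

/-- `c(t)`, the coefficient of the Simons operator in the `n₂` direction. -/
noncomputable def fsc (k l r t : ℝ) : ℝ :=
  k ^ 2 * l ^ 2 / (r ^ 2 * fsRho k l r t ^ 2) *
    (l * Real.cosh (l * t) * Real.cosh (k * t) - k * Real.sinh (l * t) * Real.sinh (k * t))

/-- Differentiation commutes with pairing against a fixed vector. -/
theorem inner_deriv_eq_of_hasDerivAt {f : ℝ → EuclideanSpace ℝ (Fin 4)}
    {w : EuclideanSpace ℝ (Fin 4)} {x d : ℝ} (hf : DifferentiableAt ℝ f x)
    (hd : HasDerivAt (fun y => ⟪f y, w⟫) d x) : ⟪deriv f x, w⟫ = d := by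
  have h := HasDerivAt.inner ℝ hf.hasDerivAt (hasDerivAt_const x w)
  simpa using h.unique hd

theorem differentiable_fsN1_angle (k l r t : ℝ) :
    Differentiable ℝ (fun φ => fsN1 k l r t φ) := by
  rw [differentiable_euclidean]
  intro i
  fin_cases i <;> simp [fsN1] <;> fun_prop

theorem inner_fsN1_fsN2 (k l r s t φ θ : ℝ) :
    ⟪fsN1 k l r s φ, fsN2 k l r t θ⟫ =
      k * l / (r * fsRho k l r s) * (k * l / (r * fsRho k l r t)) *
        (Real.sinh (k * s) * Real.cosh (k * t) * Real.sin (l * θ - l * φ) +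
          Real.cosh (l * s) * Real.sinh (l * t) * Real.sin (k * θ - k * φ)) := by
  simp [fsN1, fsN2, PiLp.inner_apply, Fin.sum_univ_four, Real.sin_sub]
  ring

/-- `⟨∂n₁/∂θ, n₂⟩ = −b(t)` and `⟨∂n₁/∂t, n₂⟩ = 0`: the connection coefficients of
the normal connection of the Fraser–Sargent surface in the frame `n₁, n₂`. -/
theorem stmt_9 (k l T r : ℝ) (hkl : k > l) (hl : l > 0) (hT : 0 < T)
    (hTeq : k * Real.tanh (k * T) = l * (Real.cosh (l * T) / Real.sinh (l * T)))
    (hr : r = Real.sqrt (k ^ 2 * Real.sinh (l * T) ^ 2 + l ^ 2 * Real.cosh (k * T) ^ 2)) :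
    ∀ t θ : ℝ,
      ⟪deriv (fun φ => fsN1 k l r t φ) θ, fsN2 k l r t θ⟫ = -fsb k l r t ∧
      ⟪deriv (fun s => fsN1 k l r s θ) t, fsN2 k l r t θ⟫ = 0 := by
  intro t θ
  constructor
  · refine inner_deriv_eq_of_hasDerivAt (differentiable_fsN1_angle k l r t θ) ?_
    simp only [inner_fsN1_fsN2]
    have hsin (m : ℝ) : HasDerivAt (fun φ => Real.sin (m * θ - m * φ)) (-m) θ := by
      simpa using (((hasDerivAt_id θ).const_mul m).const_sub (m * θ)).sin
    refine ((((hsin l).const_mul (Real.sinh (k * t) * Real.cosh (k * t))).add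
      ((hsin k).const_mul (Real.cosh (l * t) * Real.sinh (l * t)))).const_mul
        (k * l / (r * fsRho k l r t) * (k * l / (r * fsRho k l r t)))).congr_deriv ?_
    rw [fsb, div_mul_div_comm]
    ring
  · by_cases hf : DifferentiableAt ℝ (fun s => fsN1 k l r s θ) t
    · refine inner_deriv_eq_of_hasDerivAt hf ?_
      simpa [inner_fsN1_fsN2] using hasDerivAt_const t (0 : ℝ)
    · simp [deriv_zero_of_not_differentiableAt hf]
end

section
/- The integral ∫_{−∞}^{∞} ( |ĥ'(t)|² + ⟨A(k,t)·ĥ(t), ĥ(t)⟩ ) dt converges and equals 0, where |·| and ⟨·,·⟩ are the Euclidean norm and inner product on ℝ². -/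
open Real RealInnerProductSpace

open Matrix MeasureTheory

/-- The matrix `A(m,t)` of the separated Jacobi (Sturm–Liouville) problem. -/
noncomputable def fsA (k l r m t : ℝ) : Matrix (Fin 2) (Fin 2) ℝ :=
  !![fsb k l r t ^ 2 + m ^ 2 - 2 * fsa k l r t ^ 2, -(2 * m * fsb k l r t);
     -(2 * m * fsb k l r t), fsb k l r t ^ 2 + m ^ 2 - 2 * fsc k l r t ^ 2]

/-- The vector function `ĥ(t) = (ĥ₁(t), ĥ₂(t))`. -/
noncomputable def fsH (k l r t : ℝ) : Fin 2 → ℝ :=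
  ![k * l / (r * fsRho k l r t) * Real.cosh (l * t),
    k * l / (r * fsRho k l r t) * Real.sinh (l * t)]

lemma sinh_sq_add_cosh_sq_pos (x y : ℝ) : 0 < sinh x ^ 2 + cosh y ^ 2 := by
  have := cosh_pos y
  positivity

lemma fsRho_coeff {k l r : ℝ} (hk : 0 < k) (hl : 0 < l) (hr : 0 < r) (t : ℝ) :
    k * l / (r * fsRho k l r t) = (√(sinh (l * t) ^ 2 + cosh (k * t) ^ 2))⁻¹ := by
  have hq := sqrt_pos.2 (sinh_sq_add_cosh_sq_pos (l * t) (k * t))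
  rw [fsRho]
  field_simp

lemma fsRho_coeff_sq {k l r : ℝ} (hk : 0 < k) (hl : 0 < l) (hr : 0 < r) (t : ℝ) :
    k ^ 2 * l ^ 2 / (r ^ 2 * fsRho k l r t ^ 2) =
      (sinh (l * t) ^ 2 + cosh (k * t) ^ 2)⁻¹ := by
  have hD := sinh_sq_add_cosh_sq_pos (l * t) (k * t)
  rw [fsRho, mul_pow, sq_sqrt hD.le]
  field_simp

lemma hasDerivAt_sinh_mul (l t : ℝ) :
    HasDerivAt (fun s => sinh (l * s)) (l * cosh (l * t)) t := by
  simpa [mul_comm] using ((hasDerivAt_id t).const_mul l).sinh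

lemma hasDerivAt_cosh_mul (l t : ℝ) :
    HasDerivAt (fun s => cosh (l * s)) (l * sinh (l * t)) t := by
  simpa [mul_comm] using ((hasDerivAt_id t).const_mul l).cosh

lemma hasDerivAt_sinh_sq_add_cosh_sq (k l t : ℝ) :
    HasDerivAt (fun s => sinh (l * s) ^ 2 + cosh (k * s) ^ 2)
      (2 * (l * sinh (l * t) * cosh (l * t) + k * sinh (k * t) * cosh (k * t))) t := by
  convert! ((hasDerivAt_sinh_mul l t).pow 2).add ((hasDerivAt_cosh_mul k t).pow 2) using 1
  push_cast
  ring

/-- The square of the derivative of `w / √D`. -/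
lemma deriv_inv_sqrt_mul_sq {w D : ℝ → ℝ} {w' D' t : ℝ} (hw : HasDerivAt w w' t)
    (hD : HasDerivAt D D' t) (hpos : 0 < D t) :
    deriv (fun s => (√(D s))⁻¹ * w s) t ^ 2 = (w' * D t - w t * D' / 2) ^ 2 / D t ^ 3 := by
  have hq := sqrt_pos.2 hpos
  have h := ((hD.sqrt hpos.ne').inv hq.ne').mul hw
  rw [show deriv (fun s => (√(D s))⁻¹ * w s) t = _ from h.deriv]
  obtain ⟨q, hqD⟩ : ∃ q, √(D t) = q := ⟨_, rfl⟩
  have hsq : D t = q ^ 2 := by rw [← hqD, sq_sqrt hpos.le]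
  simp only [Pi.inv_apply, hqD]
  rw [hqD] at hq
  rw [hsq]
  field_simp
  ring

/-- The integrand of the quadratic form of `fsH`, written as a rational function of
`C = cosh (l t)`, `S = sinh (l t)`, `P = cosh (k t)`, `Q = sinh (k t)`. -/
noncomputable def energyDensity (k l C S P Q : ℝ) : ℝ :=
  let D := S ^ 2 + P ^ 2
  let E := l * S * C + k * Q * P
  let a := (k * C * P - l * S * Q) / D
  let b := (l * Q * P + k * S * C) / D
  let c := (l * C * P - k * S * Q) / D
  l ^ 2 * ((C ^ 2 + S ^ 2) / D) - 4 * l * (S * C / D) * (E / D)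
    + (E / D) ^ 2 * ((C ^ 2 + S ^ 2) / D) + (b ^ 2 + k ^ 2) * ((C ^ 2 + S ^ 2) / D)
    - 2 * a ^ 2 * (C ^ 2 / D) - 2 * c ^ 2 * (S ^ 2 / D) - 4 * k * b * (S * C / D)

lemma energyDensity_eq {k l r : ℝ} (hk : 0 < k) (hl : 0 < l) (hr : 0 < r) (t : ℝ) :
    (deriv (fun s => fsH k l r s 0) t) ^ 2 + (deriv (fun s => fsH k l r s 1) t) ^ 2 +
        (fsA k l r k t *ᵥ fsH k l r t) ⬝ᵥ fsH k l r t =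
      energyDensity k l (cosh (l * t)) (sinh (l * t)) (cosh (k * t)) (sinh (k * t)) := by
  have hpos := sinh_sq_add_cosh_sq_pos (l * t) (k * t)
  have hD := hasDerivAt_sinh_sq_add_cosh_sq k l t
  have h0 := deriv_inv_sqrt_mul_sq (hasDerivAt_cosh_mul l t) hD hpos
  have h1 := deriv_inv_sqrt_mul_sq (hasDerivAt_sinh_mul l t) hD hpos
  have hsq := sq_sqrt hpos.le
  have hq := sqrt_pos.2 hpos
  simp only [fsH, fsA, fsa, fsb, fsc, fsRho_coeff hk hl hr, fsRho_coeff_sq hk hl hr,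
    Matrix.cons_val_zero, Matrix.cons_val_one, h0, h1, Matrix.mulVec, dotProduct,
    Fin.sum_univ_two, Matrix.of_apply, Matrix.cons_val', Matrix.cons_val_fin_one, energyDensity]
  generalize √(sinh (l * t) ^ 2 + cosh (k * t) ^ 2) = q at hsq hq ⊢
  rw [← hsq]
  field_simp
  ring

lemma energyDensity_eq_div {k l C S P Q : ℝ} (hC : C ^ 2 = 1 + S ^ 2) (hP : P ^ 2 = 1 + Q ^ 2) :
    energyDensity k l C S P Q =
      ((l ^ 2 * (C ^ 2 + S ^ 2) * (1 + 2 * Q ^ 2) + 4 * k * l * S * C * Q * P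
          - k ^ 2 * (P ^ 2 + Q ^ 2) * (1 + 2 * S ^ 2) - 4 * k * l * S * C * Q * P)
            * (S ^ 2 + P ^ 2)
        - 4 * (l * S * C * (1 + 2 * Q ^ 2) - k * Q * P * (1 + 2 * S ^ 2))
            * (l * S * C + k * Q * P)) / (S ^ 2 + P ^ 2) ^ 3 := by
  have hD : S ^ 2 + P ^ 2 ≠ 0 := by rw [hP]; positivity
  unfold energyDensity
  field_simp
  have hC3 : C ^ 3 = C * (1 + S ^ 2) := by rw [pow_succ, hC, mul_comm]
  have hC4 : C ^ 4 = (1 + S ^ 2) ^ 2 := by rw [← hC]; ring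
  have hP3 : P ^ 3 = P * (1 + Q ^ 2) := by rw [pow_succ, hP, mul_comm]
  have hP4 : P ^ 4 = (1 + Q ^ 2) ^ 2 := by rw [← hP]; ring
  ring_nf
  simp only [hC, hC3, hC4, hP, hP3, hP4]
  ring

lemma abs_mul_div_le_one {x y D : ℝ} (hD : 0 < D) (hx : x ^ 2 ≤ D) (hy : y ^ 2 ≤ D) :
    |x * y / D| ≤ 1 := by
  rw [abs_div, abs_of_pos hD, div_le_one hD, abs_mul]
  nlinarith [sq_nonneg (|x| - |y|), sq_abs x, sq_abs y]

lemma abs_add_le_of_abs_le_one {k l x y : ℝ} (hk : 0 < k) (hl : 0 < l) (hx : |x| ≤ 1)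
    (hy : |y| ≤ 1) : |k * x + l * y| ≤ k + l := by
  rw [abs_le] at *
  constructor <;> nlinarith

lemma abs_energyDensity_le {k l C S P Q : ℝ} (hk : 0 < k) (hl : 0 < l)
    (hC : C ^ 2 = 1 + S ^ 2) (hP : P ^ 2 = 1 + Q ^ 2) :
    |energyDensity k l C S P Q| ≤ 12 * (k + l) ^ 2 * ((C ^ 2 + S ^ 2) / (S ^ 2 + P ^ 2)) := by
  have hD : 0 < S ^ 2 + P ^ 2 := by rw [hP]; positivity
  have hSD : S ^ 2 ≤ S ^ 2 + P ^ 2 := by nlinarith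
  have hPD : P ^ 2 ≤ S ^ 2 + P ^ 2 := by nlinarith
  have hCD : C ^ 2 ≤ S ^ 2 + P ^ 2 := by nlinarith
  have hQD : Q ^ 2 ≤ S ^ 2 + P ^ 2 := by nlinarith
  have hw : |S * C / (S ^ 2 + P ^ 2)| ≤ (C ^ 2 + S ^ 2) / (S ^ 2 + P ^ 2) / 2 := by
    rw [abs_div, abs_of_pos hD, div_right_comm]
    gcongr
    rw [abs_mul]
    nlinarith [sq_nonneg (|S| - |C|), sq_abs S, sq_abs C]
  have hE : |(l * S * C + k * Q * P) / (S ^ 2 + P ^ 2)| ≤ k + l := by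
    convert! abs_add_le_of_abs_le_one hk hl (abs_mul_div_le_one hD hQD hPD)
      (abs_mul_div_le_one hD hSD hCD) using 2
    ring
  have ha : |(k * C * P - l * S * Q) / (S ^ 2 + P ^ 2)| ≤ k + l := by
    convert! abs_add_le_of_abs_le_one hk hl (abs_mul_div_le_one hD hCD hPD)
      ((abs_neg _).trans_le (abs_mul_div_le_one hD hSD hQD)) using 2
    ring
  have hb : |(l * Q * P + k * S * C) / (S ^ 2 + P ^ 2)| ≤ k + l := by
    convert! abs_add_le_of_abs_le_one hk hl (abs_mul_div_le_one hD hSD hCD)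
      (abs_mul_div_le_one hD hQD hPD) using 2
    ring
  have hc : |(l * C * P - k * S * Q) / (S ^ 2 + P ^ 2)| ≤ k + l := by
    convert! abs_add_le_of_abs_le_one hk hl
      ((abs_neg _).trans_le (abs_mul_div_le_one hD hSD hQD))
      (abs_mul_div_le_one hD hCD hPD) using 2
    ring
  have hCw : 0 ≤ C ^ 2 / (S ^ 2 + P ^ 2) := by positivity
  have hSw : 0 ≤ S ^ 2 / (S ^ 2 + P ^ 2) := by positivity
  have hsum := add_div (C ^ 2) (S ^ 2) (S ^ 2 + P ^ 2)
  simp only [energyDensity]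
  generalize (C ^ 2 + S ^ 2) / (S ^ 2 + P ^ 2) = w at *
  generalize S * C / (S ^ 2 + P ^ 2) = u at *
  generalize (l * S * C + k * Q * P) / (S ^ 2 + P ^ 2) = e at *
  generalize (k * C * P - l * S * Q) / (S ^ 2 + P ^ 2) = a at *
  generalize (l * Q * P + k * S * C) / (S ^ 2 + P ^ 2) = b at *
  generalize (l * C * P - k * S * Q) / (S ^ 2 + P ^ 2) = c at *
  generalize C ^ 2 / (S ^ 2 + P ^ 2) = x at *
  generalize S ^ 2 / (S ^ 2 + P ^ 2) = y at *
  have hw0 : 0 ≤ w := by linarith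
  have hM : 0 < k + l := by positivity
  have he2 : e ^ 2 ≤ (k + l) ^ 2 := sq_le_sq' (abs_le.1 hE).1 (abs_le.1 hE).2
  have ha2 : a ^ 2 ≤ (k + l) ^ 2 := sq_le_sq' (abs_le.1 ha).1 (abs_le.1 ha).2
  have hb2 : b ^ 2 ≤ (k + l) ^ 2 := sq_le_sq' (abs_le.1 hb).1 (abs_le.1 hb).2
  have hc2 : c ^ 2 ≤ (k + l) ^ 2 := sq_le_sq' (abs_le.1 hc).1 (abs_le.1 hc).2
  have hk2 : k ^ 2 ≤ (k + l) ^ 2 := by gcongr; linarith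
  have hl2 : l ^ 2 ≤ (k + l) ^ 2 := by gcongr; linarith
  have hue : |l * u * e| ≤ (k + l) * (w / 2) * (k + l) := by
    rw [abs_mul, abs_mul, abs_of_pos hl]
    gcongr
    linarith
  have hbu : |k * b * u| ≤ (k + l) * (k + l) * (w / 2) := by
    rw [abs_mul, abs_mul, abs_of_pos hk]
    gcongr
    linarith
  rw [abs_le] at hue hbu ⊢
  have h1 := mul_le_mul_of_nonneg_right he2 hw0
  have h2 := mul_le_mul_of_nonneg_right hb2 hw0
  have h3 := mul_le_mul_of_nonneg_right hk2 hw0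
  have h4 := mul_le_mul_of_nonneg_right hl2 hw0
  have h5 := mul_le_mul_of_nonneg_right ha2 hCw
  have h6 := mul_le_mul_of_nonneg_right hc2 hSw
  have h7 : (k + l) ^ 2 * w = (k + l) ^ 2 * x + (k + l) ^ 2 * y := by rw [hsum]; ring
  have h8 : 0 ≤ e ^ 2 * w := by positivity
  have h9 : 0 ≤ (b ^ 2 + k ^ 2) * w := by positivity
  have h10 : 0 ≤ l ^ 2 * w := by positivity
  have h11 : 0 ≤ a ^ 2 * x := by positivity
  have h12 : 0 ≤ c ^ 2 * y := by positivity
  constructor <;> linarith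

/-- An odd primitive of the energy density. -/
noncomputable def energyPrimitive (k l t : ℝ) : ℝ :=
  (l * sinh (l * t) * cosh (l * t) * (1 + 2 * sinh (k * t) ^ 2)
    - k * sinh (k * t) * cosh (k * t) * (1 + 2 * sinh (l * t) ^ 2)) /
  (sinh (l * t) ^ 2 + cosh (k * t) ^ 2) ^ 2

lemma hasDerivAt_energyPrimitive (k l t : ℝ) :
    HasDerivAt (energyPrimitive k l)
      (energyDensity k l (cosh (l * t)) (sinh (l * t)) (cosh (k * t)) (sinh (k * t))) t := by
  have hpos := sinh_sq_add_cosh_sq_pos (l * t) (k * t)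
  have hSl := hasDerivAt_sinh_mul l t
  have hCl := hasDerivAt_cosh_mul l t
  have hSk := hasDerivAt_sinh_mul k t
  have hCk := hasDerivAt_cosh_mul k t
  have hD := hasDerivAt_sinh_sq_add_cosh_sq k l t
  rw [energyDensity_eq_div (cosh_sq' _) (cosh_sq' _)]
  convert! ((((hSl.const_mul l).mul hCl).mul (((hSk.pow 2).const_mul 2).const_add 1)).sub
    (((hSk.const_mul k).mul hCk).mul (((hSl.pow 2).const_mul 2).const_add 1))).div
    (hD.pow 2) (pow_pos hpos 2).ne' using 1
  simp only [Pi.mul_apply, Pi.pow_apply, Pi.sub_apply]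
  field_simp
  push_cast
  ring

lemma abs_energyPrimitive_le {k l : ℝ} (hk : 0 < k) (hl : 0 < l) (t : ℝ) :
    |energyPrimitive k l t| ≤ (k + l) *
      ((cosh (l * t) ^ 2 + sinh (l * t) ^ 2) / (sinh (l * t) ^ 2 + cosh (k * t) ^ 2)) := by
  have hD := sinh_sq_add_cosh_sq_pos (l * t) (k * t)
  have hC := cosh_sq' (l * t)
  have hP := cosh_sq' (k * t)
  rw [energyPrimitive]
  generalize cosh (l * t) = C at *
  generalize sinh (l * t) = S at *
  generalize cosh (k * t) = P at *
  generalize sinh (k * t) = Q at *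
  have hQP : |Q * P| ≤ S ^ 2 + P ^ 2 := by
    rw [abs_le]
    constructor <;> nlinarith [sq_nonneg (Q - P), sq_nonneg (Q + P)]
  have hSC : |S * C| ≤ (C ^ 2 + S ^ 2) / 2 := by
    rw [abs_le]
    constructor <;> nlinarith [sq_nonneg (S - C), sq_nonneg (S + C)]
  have h1 : |l * (S * C) * (1 + 2 * Q ^ 2)| ≤
      l * ((C ^ 2 + S ^ 2) / 2) * (2 * (S ^ 2 + P ^ 2)) := by
    rw [abs_mul, abs_mul, abs_of_pos hl, abs_of_pos (by positivity : 0 < 1 + 2 * Q ^ 2)]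
    gcongr
    nlinarith
  have h2 : |k * (Q * P) * (1 + 2 * S ^ 2)| ≤ k * (S ^ 2 + P ^ 2) * (C ^ 2 + S ^ 2) := by
    have hCS : 1 + 2 * S ^ 2 = C ^ 2 + S ^ 2 := by linarith
    rw [hCS, abs_mul, abs_mul, abs_of_pos hk, abs_of_nonneg (by positivity : 0 ≤ C ^ 2 + S ^ 2)]
    gcongr
  rw [abs_div, abs_of_pos (pow_pos hD 2), div_le_iff₀ (pow_pos hD 2)]
  have h3 : (k + l) * ((C ^ 2 + S ^ 2) / (S ^ 2 + P ^ 2)) * (S ^ 2 + P ^ 2) ^ 2 =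
      (k + l) * (C ^ 2 + S ^ 2) * (S ^ 2 + P ^ 2) := by
    field_simp
  rw [h3]
  rw [abs_le] at *
  constructor <;> linarith

lemma decay_bound {k l : ℝ} (hl : 0 < l) (hkl : l < k) (t : ℝ) :
    (cosh (l * t) ^ 2 + sinh (l * t) ^ 2) / (sinh (l * t) ^ 2 + cosh (k * t) ^ 2) ≤
      2 * (1 + ((k - l) * t) ^ 2)⁻¹ := by
  have hpos := sinh_sq_add_cosh_sq_pos (l * t) (k * t)
  have hadd : cosh (k * t) =
      cosh ((k - l) * t) * cosh (l * t) + sinh ((k - l) * t) * sinh (l * t) := by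
    rw [← cosh_add]; ring_nf
  have hsinh : 0 ≤ sinh ((k - l) * t) * sinh (l * t) := by
    rcases le_total 0 t with ht | ht
    · exact mul_nonneg (sinh_nonneg_iff.2 (mul_nonneg (by linarith) ht))
        (sinh_nonneg_iff.2 (mul_nonneg hl.le ht))
    · exact mul_nonneg_of_nonpos_of_nonpos
        (sinh_nonpos_iff.2 (mul_nonpos_of_nonneg_of_nonpos (by linarith) ht))
        (sinh_nonpos_iff.2 (mul_nonpos_of_nonneg_of_nonpos hl.le ht))
  have hsq : ((k - l) * t) ^ 2 ≤ sinh ((k - l) * t) ^ 2 := by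
    rw [sq_le_sq, abs_sinh]
    exact self_le_sinh_iff.2 (abs_nonneg _)
  have hmul : (cosh ((k - l) * t) * cosh (l * t)) ^ 2 ≤ cosh (k * t) ^ 2 := by
    have h1 := cosh_pos ((k - l) * t)
    have h2 := cosh_pos (l * t)
    rw [hadd]
    gcongr
    linarith
  rw [mul_pow, cosh_sq' ((k - l) * t)] at hmul
  rw [← div_eq_mul_inv, div_le_div_iff₀ hpos (by positivity)]
  have h3 := mul_le_mul_of_nonneg_right hsq (sq_nonneg (cosh (l * t)))
  have h4 := cosh_sq' (l * t)
  nlinarith [sq_nonneg ((k - l) * t), sq_nonneg (sinh (l * t))]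

lemma integrable_inv_one_add_mul_sq {c : ℝ} (hc : c ≠ 0) :
    Integrable fun t : ℝ => (1 + (c * t) ^ 2)⁻¹ :=
  integrable_inv_one_add_sq.comp_mul_left' hc

lemma integrable_of_abs_le_decay {k l K : ℝ} (hl : 0 < l) (hkl : l < k) (hK : 0 ≤ K)
    {f : ℝ → ℝ} (hf : AEStronglyMeasurable f)
    (hbound : ∀ t, |f t| ≤ K * ((cosh (l * t) ^ 2 + sinh (l * t) ^ 2) /
      (sinh (l * t) ^ 2 + cosh (k * t) ^ 2))) : Integrable f := by
  refine (((integrable_inv_one_add_mul_sq (sub_pos.2 hkl).ne').const_mul 2).const_mul K).mono' hf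
    (Filter.Eventually.of_forall fun t => (hbound t).trans ?_)
  exact mul_le_mul_of_nonneg_left (decay_bound hl hkl t) hK

/-- `∫_{−∞}^{∞} (|ĥ'(t)|² + ⟨A(k,t)·ĥ(t), ĥ(t)⟩) dt` converges and equals `0`,
with the Euclidean norm and inner product on `ℝ²`. -/
theorem stmt_11 (k l T r : ℝ) (hkl : k > l) (hl : l > 0) (hT : 0 < T)
    (hTeq : k * Real.tanh (k * T) = l * (Real.cosh (l * T) / Real.sinh (l * T)))
    (hr : r = Real.sqrt (k ^ 2 * Real.sinh (l * T) ^ 2 + l ^ 2 * Real.cosh (k * T) ^ 2)) :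
    Integrable (fun t : ℝ =>
      (deriv (fun s => fsH k l r s 0) t) ^ 2 + (deriv (fun s => fsH k l r s 1) t) ^ 2 +
        (fsA k l r k t *ᵥ fsH k l r t) ⬝ᵥ fsH k l r t) ∧
    (∫ t : ℝ,
      ((deriv (fun s => fsH k l r s 0) t) ^ 2 + (deriv (fun s => fsH k l r s 1) t) ^ 2 +
        (fsA k l r k t *ᵥ fsH k l r t) ⬝ᵥ fsH k l r t)) = 0 := by
  have hk : 0 < k := hl.trans hkl
  have hr0 : 0 < r := by
    rw [hr]
    have := cosh_pos (k * T)
    positivity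
  simp only [energyDensity_eq hk hl hr0]
  have hderiv := hasDerivAt_energyPrimitive k l
  have hint : Integrable fun t : ℝ =>
      energyDensity k l (cosh (l * t)) (sinh (l * t)) (cosh (k * t)) (sinh (k * t)) := by
    refine integrable_of_abs_le_decay hl hkl (K := 12 * (k + l) ^ 2) (by positivity) ?_ fun t =>
      abs_energyDensity_le hk hl (cosh_sq' _) (cosh_sq' _)
    rw [← funext fun t => (hderiv t).deriv]
    exact (measurable_deriv _).aestronglyMeasurable
  have hcont : Continuous (energyPrimitive k l) :=
    continuous_iff_continuousAt.2 fun t => (hderiv t).continuousAt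
  exact ⟨hint, integral_eq_zero_of_hasDerivAt_of_integrable hderiv hint
    (integrable_of_abs_le_decay hl hkl (by positivity) hcont.aestronglyMeasurable
      (abs_energyPrimitive_le hk hl))⟩
end

section
/- For every t ∈ ℝ one has 0 ≤ b(t)·tanh(2·l·t) < k, with equality on the left if and only if t = 0. -/
open Real RealInnerProductSpace

/-- In terms of doubled arguments,
`b(t) = (l·sinh(2kt) + k·sinh(2lt)) / (cosh(2kt) + cosh(2lt))`. -/
theorem fsb_eq_double_angle {k l r : ℝ} (hk : k ≠ 0) (hl : l ≠ 0) (hr : r ≠ 0) (t : ℝ) :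
    fsb k l r t = (l * sinh (2 * k * t) + k * sinh (2 * l * t)) /
      (cosh (2 * k * t) + cosh (2 * l * t)) := by
  have hS : 0 < sinh (l * t) ^ 2 + cosh (k * t) ^ 2 := by
    have := cosh_pos (k * t)
    positivity
  have hρ : r ^ 2 * fsRho k l r t ^ 2 =
      k ^ 2 * l ^ 2 * (sinh (l * t) ^ 2 + cosh (k * t) ^ 2) := by
    rw [fsRho, mul_pow, sq_sqrt hS.le]
    field_simp
  have hD : cosh (2 * k * t) + cosh (2 * l * t) =
      2 * (sinh (l * t) ^ 2 + cosh (k * t) ^ 2) := by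
    rw [mul_assoc, mul_assoc, cosh_two_mul, cosh_two_mul]
    linarith [cosh_sq (l * t), cosh_sq (k * t)]
  rw [fsb, hρ, hD, mul_assoc 2 k t, mul_assoc 2 l t, sinh_two_mul, sinh_two_mul]
  field_simp

theorem fsb_mul_tanh_neg {k l r : ℝ} (t : ℝ) :
    fsb k l r (-t) * tanh (2 * l * -t) = fsb k l r t * tanh (2 * l * t) := by
  simp only [fsb, fsRho, mul_neg, sinh_neg, cosh_neg, tanh_neg]
  ring_nf

theorem fsb_mul_tanh_mem_Ioo {k l r t : ℝ} (hl : 0 < l) (hkl : l < k) (hr : r ≠ 0)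
    (ht : 0 < t) : fsb k l r t * tanh (2 * l * t) ∈ Set.Ioo 0 k := by
  have hk : 0 < k := hl.trans hkl
  have hsk : 0 < sinh (2 * k * t) := sinh_pos_iff.2 (by positivity)
  have hsl : 0 < sinh (2 * l * t) := sinh_pos_iff.2 (by positivity)
  have hck := cosh_pos (2 * k * t)
  have hcl := cosh_pos (2 * l * t)
  rw [fsb_eq_double_angle hk.ne' hl.ne' hr, tanh_eq_sinh_div_cosh, div_mul_div_comm]
  refine ⟨by positivity, ?_⟩
  rw [div_lt_iff₀ (by positivity)]
  have hprod : sinh (2 * k * t) * sinh (2 * l * t) ≤ cosh (2 * k * t) * cosh (2 * l * t) :=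
    mul_le_mul (sinh_lt_cosh _).le (sinh_lt_cosh _).le hsl.le hck.le
  have hlk : l * (sinh (2 * k * t) * sinh (2 * l * t)) ≤
      k * (cosh (2 * k * t) * cosh (2 * l * t)) :=
    mul_le_mul hkl.le hprod (by positivity) hk.le
  linear_combination hlk + hk - k * cosh_sq (2 * l * t)

/-- For every `t ∈ ℝ`, `0 ≤ b(t)·tanh(2·l·t) < k`, with equality on the left
if and only if `t = 0`. -/
theorem stmt_13 (k l T r : ℝ) (hkl : k > l) (hl : l > 0) (hT : 0 < T)
    (hTeq : k * Real.tanh (k * T) = l * (Real.cosh (l * T) / Real.sinh (l * T)))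
    (hr : r = Real.sqrt (k ^ 2 * Real.sinh (l * T) ^ 2 + l ^ 2 * Real.cosh (k * T) ^ 2)) :
    ∀ t : ℝ,
      0 ≤ fsb k l r t * Real.tanh (2 * l * t) ∧
      fsb k l r t * Real.tanh (2 * l * t) < k ∧
      (fsb k l r t * Real.tanh (2 * l * t) = 0 ↔ t = 0) := by
  have hk : 0 < k := hl.trans hkl
  have hr0 : r ≠ 0 := by
    have := cosh_pos (k * T)
    rw [hr]
    positivity
  intro t
  rcases lt_trichotomy t 0 with ht | rfl | ht
  · have h := fsb_mul_tanh_mem_Ioo hl hkl hr0 (neg_pos.2 ht)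
    rw [fsb_mul_tanh_neg] at h
    exact ⟨h.1.le, h.2, iff_of_false h.1.ne' ht.ne⟩
  · simp [hk]
  · have h := fsb_mul_tanh_mem_Ioo hl hkl hr0 ht
    exact ⟨h.1.le, h.2, iff_of_false h.1.ne' ht.ne'⟩
end

section
/- For every real number p > 1, one has p·T_p > T_∞. -/
theorem Real.strictMono_tanh : StrictMono Real.tanh := by
  intro x y hxy
  have h : 0 < Real.sinh (y - x) := Real.sinh_pos_iff.2 (sub_pos.2 hxy)
  rw [Real.sinh_sub] at h
  rw [Real.tanh_eq_sinh_div_cosh, Real.tanh_eq_sinh_div_cosh,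
    div_lt_div_iff₀ (Real.cosh_pos x) (Real.cosh_pos y)]
  linarith

theorem Real.sinh_lt_mul_cosh {x : ℝ} (hx : 0 < x) : Real.sinh x < x * Real.cosh x := by
  have hderiv (y : ℝ) : HasDerivAt (fun t ↦ t * Real.cosh t - Real.sinh t) (y * Real.sinh y) y := by
    refine (((hasDerivAt_id' y).mul (Real.hasDerivAt_cosh y)).sub
      (Real.hasDerivAt_sinh y)).congr_deriv ?_
    ring
  have hmono : StrictMonoOn (fun t ↦ t * Real.cosh t - Real.sinh t) (Set.Ici 0) := by
    refine strictMonoOn_of_deriv_pos (convex_Ici 0) (by fun_prop) fun y hy ↦ ?_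
    rw [interior_Ici, Set.mem_Ioi] at hy
    rw [(hderiv y).deriv]
    exact mul_pos hy (Real.sinh_pos_iff.2 hy)
  simpa using hmono Set.self_mem_Ici hx.le hx

/-- For every real `p > 1`, `p·T_p > T_∞`, where `T_p` is the unique positive
solution of `p·tanh(p·t) = coth(t)` and `T_∞` the unique positive solution of
`t·tanh(t) = 1`. -/
theorem stmt_14 (p Tp Tinf : ℝ) (hp : 1 < p) (hTp : 0 < Tp)
    (hTpeq : p * Real.tanh (p * Tp) = Real.cosh Tp / Real.sinh Tp)
    (hTinf : 0 < Tinf) (hTinfeq : Tinf * Real.tanh Tinf = 1) :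
    Tinf < p * Tp := by
  have hsinh : 0 < Real.sinh Tp := Real.sinh_pos_iff.2 hTp
  have hx : 0 < p * Tp := by positivity
  have hone : 1 < p * Tp * Real.tanh (p * Tp) := by
    calc 1 < Tp * Real.cosh Tp / Real.sinh Tp :=
          (one_lt_div hsinh).2 (Real.sinh_lt_mul_cosh hTp)
      _ = p * Tp * Real.tanh (p * Tp) := by rw [mul_div_assoc, ← hTpeq]; ring
  by_contra! hle
  have htanh : 0 < Real.tanh (p * Tp) := by simpa using Real.strictMono_tanh hx
  have := mul_le_mul hle (Real.strictMono_tanh.monotone hle) htanh.le hTinf.le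
  linarith
end

section
/- For every real number p > 1, one has (p − 1)·T_p < T_∞. -/
/-- For every real `p > 1`, `(p − 1)·T_p < T_∞`, where `T_p` is the unique positive
solution of `p·tanh(p·t) = coth(t)` and `T_∞` the unique positive solution of
`t·tanh(t) = 1`. -/
theorem stmt_15 (p Tp Tinf : ℝ) (hp : 1 < p) (hTp : 0 < Tp)
    (hTpeq : p * Real.tanh (p * Tp) = Real.cosh Tp / Real.sinh Tp)
    (hTinf : 0 < Tinf) (hTinfeq : Tinf * Real.tanh Tinf = 1) :
    (p - 1) * Tp < Tinf := by
  by_contra! hle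
  set u := (p - 1) * Tp with hu
  have hpT : p * Tp = u + Tp := by rw [hu]; ring
  have hs : 0 < Real.sinh Tp := Real.sinh_pos_iff.2 hTp
  have hsT : 0 < Real.sinh Tinf := Real.sinh_pos_iff.2 hTinf
  have hu0 : 0 < u := hTinf.trans_le hle
  have hS : 0 < Real.sinh u := Real.sinh_pos_iff.2 hu0
  have hC : 0 < Real.cosh u := Real.cosh_pos u
  -- `1 ≤ u * tanh u`, cleared of denominators
  have hcosh_le : Real.cosh u ≤ u * Real.sinh u := by
    have hT : Tinf * Real.sinh Tinf = Real.cosh Tinf := by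
      rw [Real.tanh_eq_sinh_div_cosh, ← mul_div_assoc,
        div_eq_one_iff_eq (Real.cosh_pos _).ne'] at hTinfeq
      exact hTinfeq
    have hdiff : 0 ≤ Real.sinh (u - Tinf) := Real.sinh_nonneg_iff.2 (sub_nonneg.2 hle)
    rw [Real.sinh_sub, ← hT] at hdiff
    have hmul : Real.cosh u * Real.sinh Tinf ≤ (Tinf * Real.sinh u) * Real.sinh Tinf := by
      linarith
    exact (le_of_mul_le_mul_right hmul hsT).trans (mul_le_mul_of_nonneg_right hle hS.le)
  have hlt : Tp < Real.cosh Tp * Real.sinh Tp :=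
    (Real.self_lt_sinh_iff.2 hTp).trans_le
      (le_mul_of_one_le_left hs.le (Real.one_le_cosh Tp))
  have hsq := Real.cosh_sq Tp
  -- the equation for `Tp`, cleared of denominators and expanded by the addition formulas
  have heq : u * (Real.sinh u * Real.cosh Tp + Real.cosh u * Real.sinh Tp) * Real.sinh Tp
      = Tp * Real.cosh u := by
    rw [hpT, Real.tanh_eq_sinh_div_cosh, ← mul_div_assoc,
      div_eq_div_iff (Real.cosh_pos _).ne' hs.ne', Real.sinh_add, Real.cosh_add] at hTpeq
    linear_combination Tp * hTpeq + Tp * Real.cosh u * hsq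
      - (Real.sinh u * Real.cosh Tp + Real.cosh u * Real.sinh Tp) * Real.sinh Tp * hpT
  have hpos : 0 < u * Real.cosh u * Real.sinh Tp ^ 2 := by positivity
  have hlower := mul_le_mul_of_nonneg_right hcosh_le
    (mul_pos (Real.cosh_pos Tp) hs).le
  have hupper := mul_lt_mul_of_pos_left hlt hC
  linarith
end

section
/- For every fixed real t ≥ 1, the function a ↦ a/cosh(a·t) is strictly decreasing on (T_∞, ∞); that is, whenever T_∞ < a₁ < a₂ and t ≥ 1, one has a₂/cosh(a₂·t) < a₁/cosh(a₁·t). -/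
/-- Beyond a positive point where `t * tanh t = 1`, one has `cosh x < x * sinh x`. -/
theorem cosh_lt_mul_sinh_of_mul_tanh_eq_one {T x : ℝ} (hT : 0 < T)
    (hT1 : T * Real.tanh T = 1) (hx : T < x) : Real.cosh x < x * Real.sinh x := by
  have hcT := Real.cosh_pos T
  have hcx := Real.cosh_pos x
  have hsT : 0 < Real.sinh T := Real.sinh_pos_iff.2 hT
  have heq : T * Real.sinh T = Real.cosh T := by
    rw [Real.tanh_eq_sinh_div_cosh] at hT1
    field_simp at hT1
    exact hT1
  have hd : 0 < Real.sinh (x - T) := Real.sinh_pos_iff.2 (sub_pos.2 hx)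
  rw [Real.sinh_sub] at hd
  refine lt_of_mul_lt_mul_right ?_ hcT.le
  calc Real.cosh x * Real.cosh T = T * (Real.cosh x * Real.sinh T) := by rw [← heq]; ring
    _ < x * (Real.cosh x * Real.sinh T) := by gcongr
    _ < x * (Real.sinh x * Real.cosh T) :=
      mul_lt_mul_of_pos_left (by linarith) (hT.trans hx)
    _ = x * Real.sinh x * Real.cosh T := by ring

/-- The graph of `cosh` lies above its tangent lines at nonnegative points, to the right. -/
theorem cosh_add_mul_sinh_le_cosh {x y : ℝ} (hx : 0 ≤ x) (hxy : x ≤ y) :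
    Real.cosh x + (y - x) * Real.sinh x ≤ Real.cosh y := by
  have h : Real.cosh y =
      Real.cosh x * Real.cosh (y - x) + Real.sinh x * Real.sinh (y - x) := by
    rw [← Real.cosh_add, add_sub_cancel]
  have h1 := mul_le_mul_of_nonneg_left (Real.one_le_cosh (y - x)) (Real.cosh_pos x).le
  have h2 := mul_le_mul_of_nonneg_left (Real.self_le_sinh_iff.2 (sub_nonneg.2 hxy))
    (Real.sinh_nonneg_iff.2 hx)
  linarith

/-- Cross-multiplied form of the strict decrease of `x / cosh x` wherever
`cosh x < x * sinh x`. -/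
theorem mul_cosh_lt_mul_cosh {x y : ℝ} (hx : 0 < x) (hxy : x < y)
    (h : Real.cosh x < x * Real.sinh x) : y * Real.cosh x < x * Real.cosh y := by
  have h1 := mul_le_mul_of_nonneg_left (cosh_add_mul_sinh_le_cosh hx.le hxy.le) hx.le
  have h2 := mul_lt_mul_of_pos_left h (sub_pos.2 hxy)
  linarith

/-- For every fixed real `t ≥ 1`, the function `a ↦ a/cosh(a·t)` is strictly
decreasing on `(T_∞, ∞)`: whenever `T_∞ < a₁ < a₂` and `t ≥ 1`, one has
`a₂/cosh(a₂·t) < a₁/cosh(a₁·t)`. Here `T_∞` is the unique positive solution of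
`t·tanh(t) = 1`. -/
theorem stmt_16 (Tinf : ℝ) (hTinf : 0 < Tinf) (hTinfeq : Tinf * Real.tanh Tinf = 1) :
    ∀ t : ℝ, 1 ≤ t →
      StrictAntiOn (fun a : ℝ => a / Real.cosh (a * t)) (Set.Ioi Tinf) ∧
      ∀ a₁ a₂ : ℝ, Tinf < a₁ → a₁ < a₂ →
        a₂ / Real.cosh (a₂ * t) < a₁ / Real.cosh (a₁ * t) := by
  intro t ht
  have key : ∀ a₁ a₂ : ℝ, Tinf < a₁ → a₁ < a₂ →
      a₂ / Real.cosh (a₂ * t) < a₁ / Real.cosh (a₁ * t) := by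
    intro a₁ a₂ h₁ h₂
    have ht0 : 0 < t := by linarith
    have ha : 0 < a₁ := hTinf.trans h₁
    have hx : Tinf < a₁ * t := h₁.trans_le (le_mul_of_one_le_right ha.le ht)
    have h := mul_cosh_lt_mul_cosh (mul_pos ha ht0) (mul_lt_mul_of_pos_right h₂ ht0)
      (cosh_lt_mul_sinh_of_mul_tanh_eq_one hTinf hTinfeq hx)
    rw [div_lt_div_iff₀ (Real.cosh_pos _) (Real.cosh_pos _)]
    refine lt_of_mul_lt_mul_right ?_ ht0.le
    linarith
  exact ⟨fun a₁ h₁ a₂ _ h₂ => key a₁ a₂ h₁ h₂, key⟩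
end

section
/- Let t₀ ∈ ℝ, let q₁, q₂ : [t₀, ∞) → ℝ be continuous with q₁(t) > q₂(t) for all t ≥ t₀, and let b₁, b₂ be real numbers with 0 < b₁ < b₂. Suppose g₁, g₂ : [t₀, ∞) → ℝ are twice differentiable and satisfy gᵢ''(t) + qᵢ(t)·gᵢ(t) = 0 on [t₀, ∞), the Robin conditions gᵢ'(t₀) = bᵢ·gᵢ(t₀), and gᵢ(t₀) ≠ 0 for i = 1, 2. If g₁(t) ≠ 0 for all t ≥ t₀, then g₂(t) ≠ 0 for all t ≥ t₀. -/
open Set in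
/-- Positive solutions version of Sturm comparison, stated through the Wronskian: if `f > 0` on
`[a,∞)`, `h a > 0`, and the Wronskian `h' f - h f'` is nonnegative at `a`, then `h > 0`
on `[a,∞)` as soon as the potential of `f` dominates that of `h`. -/
theorem sturm_pos_of_wronskian_nonneg {a : ℝ} {p q f f' h h' : ℝ → ℝ}
    (hqp : ∀ t ∈ Ici a, q t ≤ p t)
    (hf : ∀ t ∈ Ici a, HasDerivAt f (f' t) t)
    (hf' : ∀ t ∈ Ici a, HasDerivAt f' (-(p t * f t)) t)
    (hh : ∀ t ∈ Ici a, HasDerivAt h (h' t) t)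
    (hh' : ∀ t ∈ Ici a, HasDerivAt h' (-(q t * h t)) t)
    (hfpos : ∀ t ∈ Ici a, 0 < f t) (hha : 0 < h a)
    (hW : 0 ≤ h' a * f a - h a * f' a) :
    ∀ t ∈ Ici a, 0 < h t := by
  intro t ht
  by_contra! hneg
  have hcont : ContinuousOn h (Icc a t) := fun x hx =>
    (hh x hx.1).continuousAt.continuousWithinAt
  obtain ⟨s, ⟨⟨has, hst⟩, hs⟩, hmin⟩ :
      ∃ s, IsLeast (Icc a t ∩ h ⁻¹' Iic 0) s :=
    (isCompact_Icc.of_isClosed_subset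
      (hcont.preimage_isClosed_of_isClosed isClosed_Icc isClosed_Iic)
      inter_subset_left).exists_isLeast ⟨t, ⟨ht, le_rfl⟩, hneg⟩
  have hpos : ∀ x ∈ Ico a s, 0 < h x := by
    intro x hx
    by_contra! hx0
    exact absurd (hmin ⟨⟨hx.1, hx.2.le.trans hst⟩, hx0⟩) (not_le.2 hx.2)
  have hdW : ∀ x ∈ Ici a, HasDerivAt (fun x => h' x * f x - h x * f' x)
      ((p x - q x) * (f x * h x)) x := by
    intro x hx
    refine (((hh' x hx).mul (hf x hx)).sub ((hh x hx).mul (hf' x hx))).congr_deriv ?_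
    ring
  have hWmono : MonotoneOn (fun x => h' x * f x - h x * f' x) (Icc a s) := by
    refine monotoneOn_of_hasDerivWithinAt_nonneg (convex_Icc a s)
      (fun x hx => (hdW x hx.1).continuousAt.continuousWithinAt)
      (fun x hx => (hdW x (interior_subset hx).1).hasDerivWithinAt) fun x hx => ?_
    rw [interior_Icc] at hx
    exact mul_nonneg (sub_nonneg.2 (hqp x hx.1.le))
      (mul_pos (hfpos x hx.1.le) (hpos x ⟨hx.1.le, hx.2⟩)).le
  have hdu : ∀ x ∈ Ici a, HasDerivAt (fun x => h x / f x)
      ((h' x * f x - h x * f' x) / f x ^ 2) x := fun x hx =>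
    (hh x hx).div (hf x hx) (hfpos x hx).ne'
  have humono : MonotoneOn (fun x => h x / f x) (Icc a s) := by
    refine monotoneOn_of_hasDerivWithinAt_nonneg (convex_Icc a s)
      (fun x hx => (hdu x hx.1).continuousAt.continuousWithinAt)
      (fun x hx => (hdu x (interior_subset hx).1).hasDerivWithinAt) fun x hx => ?_
    have hx' := interior_subset hx
    exact div_nonneg (hW.trans (hWmono (left_mem_Icc.2 has) hx' hx'.1)) (sq_nonneg _)
  have hle : h a / f a ≤ h s / f s := humono (left_mem_Icc.2 has) (right_mem_Icc.2 has) has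
  have hua : 0 < h a / f a := div_pos hha (hfpos a self_mem_Ici)
  exact absurd (hua.trans_le hle) (not_lt.2 (div_nonpos_of_nonpos_of_nonneg hs (hfpos s has).le))

open Set in
/-- A continuous nonvanishing function on `[a,∞)` keeps the sign it has at `a`. -/
theorem mul_pos_of_continuousOn_Ici_of_ne_zero {a : ℝ} {f : ℝ → ℝ}
    (hf : ContinuousOn f (Ici a)) (hne : ∀ t ∈ Ici a, f t ≠ 0) :
    ∀ t ∈ Ici a, 0 < f a * f t := by
  intro t ht
  by_contra! hneg
  have hcont : ContinuousOn (fun x => f a * f x) (Icc a t) :=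
    continuousOn_const.mul (hf.mono Icc_subset_Ici_self)
  obtain ⟨x, hx, hx0⟩ := intermediate_value_Icc' ht hcont
    ⟨hneg, mul_self_nonneg (f a)⟩
  exact mul_ne_zero (hne a self_mem_Ici) (hne x hx.1) hx0


/-- Sturm comparison for scalar Sturm–Liouville problems on a half-line with a Robin
condition at the left endpoint: if `q₁ > q₂` on `[t₀,∞)`, `0 < b₁ < b₂`, the twice
differentiable functions `gᵢ` satisfy `gᵢ'' + qᵢ·gᵢ = 0` on `[t₀,∞)`, the Robin
conditions `gᵢ'(t₀) = bᵢ·gᵢ(t₀)` with `gᵢ(t₀) ≠ 0`, and `g₁` never vanishes on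
`[t₀,∞)`, then `g₂` never vanishes on `[t₀,∞)`. -/
theorem stmt_19 (t₀ : ℝ) (q₁ q₂ : ℝ → ℝ)
    (hq₁ : ContinuousOn q₁ (Set.Ici t₀)) (hq₂ : ContinuousOn q₂ (Set.Ici t₀))
    (hq : ∀ t ∈ Set.Ici t₀, q₂ t < q₁ t)
    (b₁ b₂ : ℝ) (hb₁ : 0 < b₁) (hb : b₁ < b₂)
    (g₁ g₂ : ℝ → ℝ)
    (hg₁ : ∀ t ∈ Set.Ici t₀, DifferentiableAt ℝ g₁ t)
    (hg₁' : ∀ t ∈ Set.Ici t₀, DifferentiableAt ℝ (deriv g₁) t)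
    (hode₁ : ∀ t ∈ Set.Ici t₀, deriv (deriv g₁) t + q₁ t * g₁ t = 0)
    (hrob₁ : deriv g₁ t₀ = b₁ * g₁ t₀) (hne₁ : g₁ t₀ ≠ 0)
    (hg₂ : ∀ t ∈ Set.Ici t₀, DifferentiableAt ℝ g₂ t)
    (hg₂' : ∀ t ∈ Set.Ici t₀, DifferentiableAt ℝ (deriv g₂) t)
    (hode₂ : ∀ t ∈ Set.Ici t₀, deriv (deriv g₂) t + q₂ t * g₂ t = 0)
    (hrob₂ : deriv g₂ t₀ = b₂ * g₂ t₀) (hne₂ : g₂ t₀ ≠ 0)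
    (hnv₁ : ∀ t ∈ Set.Ici t₀, g₁ t ≠ 0) :
    ∀ t ∈ Set.Ici t₀, g₂ t ≠ 0 := by
  intro t ht
  have hderiv : ∀ {g q : ℝ → ℝ} (c : ℝ),
      (∀ t ∈ Set.Ici t₀, DifferentiableAt ℝ (deriv g) t) →
      (∀ t ∈ Set.Ici t₀, deriv (deriv g) t + q t * g t = 0) →
      ∀ t ∈ Set.Ici t₀, HasDerivAt (fun x => c * deriv g x) (-(q t * (c * g t))) t := by
    intro g q c hg hode t ht
    refine ((hg t ht).hasDerivAt.const_mul c).congr_deriv ?_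
    linear_combination c * hode t ht
  have hpos := sturm_pos_of_wronskian_nonneg (fun t ht => (hq t ht).le)
    (fun t ht => (hg₁ t ht).hasDerivAt.const_mul (g₁ t₀)) (hderiv (g₁ t₀) hg₁' hode₁)
    (fun t ht => (hg₂ t ht).hasDerivAt.const_mul (g₂ t₀)) (hderiv (g₂ t₀) hg₂' hode₂)
    (mul_pos_of_continuousOn_Ici_of_ne_zero
      (fun t ht => (hg₁ t ht).continuousAt.continuousWithinAt) hnv₁)
    (mul_self_pos.2 hne₂) (by
      rw [hrob₁, hrob₂]
      have h := mul_nonneg (sub_nonneg.2 hb.le) (sq_nonneg (g₁ t₀ * g₂ t₀))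
      linarith) t ht
  exact right_ne_zero_of_mul hpos.ne'
end
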